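/- arXiv:math-ph/0612074 — 6 statements merged into one kernel-verified Lean document; each statement's English description precedes it below -/
import Mathlib

section
/- For every probability measure μ on ℝ and every ε ∈ (0,1), the resolution width of the smeared position observable Q_μ equals the overall width of μ: γ_ε(μ) = W_ε(μ). -/
open MeasureTheory Set
open scoped ENNReal

noncomputable section

/-- `J x δ` is the closed interval `[x - δ/2, x + δ/2]`. -/
def J (x δ : ℝ) : Set ℝ := Set.Icc (x - δ / 2) (x + δ / 2)

/-- Convolution `ν ∗ μ` of measures on `ℝ`: the output distribution of the smeared
position observable `Q_μ` when the input distribution is `ν`. -/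
def mconv (ν μ : Measure ℝ) : Measure ℝ :=
  Measure.map (fun p : ℝ × ℝ => p.1 + p.2) (ν.prod μ)

/-- The overall width `W_ε(P)` of a measure `P` at confidence level `1 - ε`
(with `inf ∅ = ∞`). -/
def overallWidth (P : Measure ℝ) (ε : ℝ) : ℝ≥0∞ :=
  ⨅ (w : ℝ) (_ : 0 < w ∧ ∃ x : ℝ, ENNReal.ofReal (1 - ε) ≤ P (J x w)),
    ENNReal.ofReal w

/-- The resolution width `γ_ε(Q_μ)` of the smeared position observable `Q_μ`
(with `inf ∅ = ∞`). -/
def resWidth (μ : Measure ℝ) (ε : ℝ) : ℝ≥0∞ :=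
  ⨅ (w : ℝ) (_ : 0 < w ∧ ∀ x : ℝ, ∃ ν : Measure ℝ, IsProbabilityMeasure ν ∧
      ENNReal.ofReal (1 - ε) ≤ mconv ν μ (J x w)),
    ENNReal.ofReal w

theorem mconv_J (ν μ : Measure ℝ) [SFinite μ] (x w : ℝ) :
    mconv ν μ (J x w) = ∫⁻ q, μ (J (x - q) w) ∂ν := by
  have hadd : Measurable fun p : ℝ × ℝ => p.1 + p.2 := by fun_prop
  have hJ : MeasurableSet (J x w) := measurableSet_Icc
  rw [mconv, Measure.map_apply hadd hJ, Measure.prod_apply (hadd hJ)]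
  refine lintegral_congr fun q => congrArg μ (Set.ext fun y => ?_)
  simp only [J, mem_preimage, mem_Icc]
  constructor <;> rintro ⟨h₁, h₂⟩ <;> constructor <;> linarith

theorem forall_exists_le_mconv_J_iff (μ : Measure ℝ) [IsFiniteMeasure μ] (c : ℝ≥0∞) (w : ℝ) :
    (∀ x : ℝ, ∃ ν : Measure ℝ, IsProbabilityMeasure ν ∧ c ≤ mconv ν μ (J x w)) ↔
      ∃ x : ℝ, c ≤ μ (J x w) := by
  constructor
  · intro h
    obtain ⟨ν, _, hc⟩ := h 0
    rw [mconv_J] at hc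
    have hfin : ∫⁻ q, μ (J (0 - q) w) ∂ν ≠ ∞ := by
      refine ne_top_of_le_ne_top (measure_ne_top μ univ) ?_
      calc ∫⁻ q, μ (J (0 - q) w) ∂ν ≤ ∫⁻ _, μ univ ∂ν :=
            lintegral_mono fun q => measure_mono (subset_univ _)
        _ = μ univ := by simp
    obtain ⟨q, hq⟩ := exists_lintegral_le hfin
    exact ⟨0 - q, hc.trans hq⟩
  · rintro ⟨x₀, h⟩ x
    refine ⟨Measure.dirac (x - x₀), inferInstance, ?_⟩
    rw [mconv_J, lintegral_dirac, sub_sub_cancel]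
    exact h

theorem resolution_width_eq_overall_width
    (μ : Measure ℝ) [IsProbabilityMeasure μ]
    (ε : ℝ) (hε : ε ∈ Set.Ioo (0 : ℝ) 1) :
    resWidth μ ε = overallWidth μ ε := by
  simp only [resWidth, overallWidth, forall_exists_le_mconv_J_iff]
end
end

section
/- (Proposition 1.) Let S be a nonempty type and e, e₁ : S → (probability measures on ℝ) be outcome-distribution maps such that e has full support: for every x ∈ ℝ and every δ > 0 there exists ρ ∈ S with (e ρ)(J_{x;δ}) = 1. Then for every ε ∈ (0,1), the error bar width of E₁ relative to E is never smaller than the resolution width of E₁: D_ε(E₁,E) ≥ γ_ε(E₁). -/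
open MeasureTheory Set
open scoped ENNReal

noncomputable section

/-- The error `W_{ε,δ}(E₁,E)` of the observable with outcome-distribution map `e₁`
relative to the one with map `e` (with `inf ∅ = ∞`). -/
def errW {S : Type*} (e e₁ : S → Measure ℝ) (ε δ : ℝ) : ℝ≥0∞ :=
  ⨅ (w : ℝ) (_ : 0 < w ∧ ∀ (x : ℝ) (ρ : S), e ρ (J x δ) = 1 →
      ENNReal.ofReal (1 - ε) ≤ e₁ ρ (J x w)),
    ENNReal.ofReal w

/-- The error bar width `D_ε(E₁,E) = inf_{δ>0} W_{ε,δ}(E₁,E)`. -/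
def errorBar {S : Type*} (e e₁ : S → Measure ℝ) (ε : ℝ) : ℝ≥0∞ :=
  ⨅ (δ : ℝ) (_ : 0 < δ), errW e e₁ ε δ

/-- The resolution width `γ_ε(E₁)` (with `inf ∅ = ∞`). -/
def resW {S : Type*} (e₁ : S → Measure ℝ) (ε : ℝ) : ℝ≥0∞ :=
  ⨅ (w : ℝ) (_ : 0 < w ∧ ∀ x : ℝ, ∃ ρ : S, ENNReal.ofReal (1 - ε) ≤ e₁ ρ (J x w)),
    ENNReal.ofReal w

/-- Proposition 1: the error bar width of `E₁` relative to `E` is never smaller than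
the resolution width of `E₁`. -/
theorem errorBar_ge_resolution_width
    {S : Type*} [Nonempty S] (e e₁ : S → Measure ℝ)
    (he : ∀ ρ, IsProbabilityMeasure (e ρ))
    (he₁ : ∀ ρ, IsProbabilityMeasure (e₁ ρ))
    (hsupp : ∀ (x δ : ℝ), 0 < δ → ∃ ρ : S, e ρ (J x δ) = 1)
    (ε : ℝ) (hε : ε ∈ Set.Ioo (0 : ℝ) 1) :
    resW e₁ ε ≤ errorBar e e₁ ε := by
  refine le_iInf₂ fun δ hδ => le_iInf₂ fun w hw => iInf₂_le w ⟨hw.1, fun x => ?_⟩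
  obtain ⟨ρ, hρ⟩ := hsupp x δ hδ
  exact ⟨ρ, hw.2 x ρ hρ⟩
end
end

section
/- Let ν and ν′ be probability measures on ℝ, let c > 0, and suppose |∫ h dν′ − ∫ h dν| ≤ c for every bounded 1-Lipschitz function h : ℝ → ℝ. If ν(J_{q;δ}) = 1 for some q ∈ ℝ and δ > 0, then for every ε ∈ (0,1), ν′(J_{q; δ + 2c/ε}) ≥ 1 − ε. -/
open MeasureTheory Set
open scoped ENNReal

noncomputable section

/-- The distance to the interval `[q - a, q + a]`, truncated at height `b`. -/
def truncatedDist (q a b x : ℝ) : ℝ := min (max (|x - q| - a) 0) b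

lemma truncatedDist_nonneg (q a : ℝ) {b : ℝ} (hb : 0 ≤ b) (x : ℝ) :
    0 ≤ truncatedDist q a b x :=
  le_min (le_max_right _ _) hb

lemma abs_truncatedDist_le (q a : ℝ) {b : ℝ} (hb : 0 ≤ b) (x : ℝ) :
    |truncatedDist q a b x| ≤ b := by
  rw [abs_of_nonneg (truncatedDist_nonneg q a hb x)]
  exact min_le_right _ _

lemma lipschitzWith_truncatedDist (q a b : ℝ) : LipschitzWith 1 (truncatedDist q a b) := by
  have h : LipschitzWith 1 fun x : ℝ => |x - q| - a :=
    LipschitzWith.of_le_add fun x y => by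
      have := abs_sub_le x y q
      rw [Real.dist_eq]
      linarith
  exact (h.max_const 0).min_const b

lemma truncatedDist_eq_zero {q a b x : ℝ} (hb : 0 ≤ b) (hx : |x - q| ≤ a) :
    truncatedDist q a b x = 0 := by
  rw [truncatedDist, max_eq_right (by linarith), min_eq_left hb]

lemma le_truncatedDist {q a b x : ℝ} (hx : a + b ≤ |x - q|) : b ≤ truncatedDist q a b x :=
  le_min (le_max_of_le_left (by linarith)) le_rfl

lemma mem_J_iff {q δ x : ℝ} : x ∈ J q δ ↔ |x - q| ≤ δ / 2 := by
  rw [abs_sub_comm]; exact Set.mem_Icc_iff_abs_le.symm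

/-- If the integrals of every bounded 1-Lipschitz function against `ν'` and `ν` differ by
at most `c`, and `ν` is concentrated on `J_{q;δ}`, then `ν'(J_{q;δ+2c/ε}) ≥ 1 - ε`. -/
theorem concentration_of_bounded_lipschitz_closeness
    (ν ν' : Measure ℝ) [IsProbabilityMeasure ν] [IsProbabilityMeasure ν']
    (c : ℝ) (hc : 0 < c)
    (hbl : ∀ h : ℝ → ℝ, (∃ C : ℝ, ∀ x, |h x| ≤ C) → LipschitzWith 1 h →
      |(∫ x, h x ∂ν') - ∫ x, h x ∂ν| ≤ c)
    (q δ : ℝ) (hδ : 0 < δ) (hν : ν (J q δ) = 1)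
    (ε : ℝ) (hε : ε ∈ Set.Ioo (0 : ℝ) 1) :
    ENNReal.ofReal (1 - ε) ≤ ν' (J q (δ + 2 * c / ε)) := by
  obtain ⟨hε0, -⟩ := hε
  have hb : 0 < c / ε := div_pos hc hε0
  set h := truncatedDist q (δ / 2) (c / ε)
  have hLip : LipschitzWith 1 h := lipschitzWith_truncatedDist _ _ _
  have hbound : ∀ x, |h x| ≤ c / ε := abs_truncatedDist_le _ _ hb.le
  have hzero : ∫ x, h x ∂ν = 0 := by
    refine integral_eq_zero_of_ae ?_
    have hmem : ∀ᵐ x ∂ν, x ∈ J q δ := (mem_ae_iff_prob_eq_one measurableSet_Icc).2 hν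
    filter_upwards [hmem] with x hx
    exact truncatedDist_eq_zero hb.le (mem_J_iff.1 hx)
  have hle : ∫ x, h x ∂ν' ≤ c := by
    have := hbl h ⟨_, hbound⟩ hLip
    rw [hzero, sub_zero] at this
    exact (le_abs_self _).trans this
  have hint : Integrable h ν' :=
    Integrable.of_bound hLip.continuous.aestronglyMeasurable (c / ε) (.of_forall hbound)
  have hmarkov : c / ε * ν'.real {x | c / ε ≤ h x} ≤ c :=
    (mul_meas_ge_le_integral_of_nonneg
      (.of_forall (truncatedDist_nonneg _ _ hb.le)) hint _).trans hle
  have htail : ν'.real {x | c / ε ≤ h x} ≤ ε := by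
    rw [div_mul_eq_mul_div, div_le_iff₀ hε0] at hmarkov
    exact le_of_mul_le_mul_left hmarkov hc
  have hsub : (J q (δ + 2 * c / ε))ᶜ ⊆ {x | c / ε ≤ h x} := by
    intro x hx
    rw [mem_compl_iff, mem_J_iff, not_le] at hx
    exact le_truncatedDist (by linarith [mul_div_assoc 2 c ε])
  have hcompl : ν'.real (J q (δ + 2 * c / ε))ᶜ ≤ ε := (measureReal_mono hsub).trans htail
  rw [probReal_compl_eq_one_sub (s := J q (δ + 2 * c / ε)) measurableSet_Icc] at hcompl
  exact ENNReal.ofReal_le_of_le_toReal (by rw [← measureReal_def]; linarith)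
end
end

section
/- (Proposition 5.) Let S be a nonempty type and e, e₁ : S → (probability measures on ℝ) be outcome-distribution maps such that e has full support: for every x ∈ ℝ and every δ > 0 there exists ρ ∈ S with (e ρ)(J_{x;δ}) = 1. Suppose there is c > 0 such that for every ρ ∈ S and every bounded 1-Lipschitz function h : ℝ → ℝ, |∫ h d(e₁ ρ) − ∫ h d(e ρ)| ≤ c (i.e. the Werner distance d(E₁,E) ≤ c is finite). Then for every ε ∈ (0,1) and δ > 0: W_{ε,δ}(E₁,E) ≤ δ + 2c/ε; hence E₁ is an approximation to E with error bar width satisfying D_ε(E₁,E) ≤ 2c/ε. -/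
open MeasureTheory Set
open scoped ENNReal

noncomputable section

/-- The trapezoid of height `K` centred at `x`: it equals `K` on `J x δ`, has slopes `±1`,
and vanishes outside `J x (δ + 2 * K)`. -/
def trapezoid (x δ K y : ℝ) : ℝ := min K (max 0 (K + δ / 2 - |y - x|))

lemma trapezoid_nonneg {K : ℝ} (hK : 0 ≤ K) (x δ y : ℝ) : 0 ≤ trapezoid x δ K y :=
  le_min hK (le_max_left _ _)

lemma trapezoid_le (x δ K y : ℝ) : trapezoid x δ K y ≤ K := min_le_left _ _

lemma lipschitzWith_trapezoid (x δ K : ℝ) : LipschitzWith 1 (trapezoid x δ K) := by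
  refine LipschitzWith.const_min (LipschitzWith.const_max ?_ _) _
  refine LipschitzWith.of_le_add fun y z => ?_
  have h := abs_sub_le z y x
  rw [Real.dist_eq, abs_sub_comm y z]
  linarith

lemma trapezoid_eq_of_mem {x δ y : ℝ} (K : ℝ) (hy : y ∈ J x δ) : trapezoid x δ K y = K := by
  have h : |y - x| ≤ δ / 2 := abs_le.2 ⟨by linarith [hy.1], by linarith [hy.2]⟩
  exact min_eq_left (le_max_of_le_right (by linarith))

lemma trapezoid_eq_zero_of_notMem {x δ K y : ℝ} (hK : 0 ≤ K) (hy : y ∉ J x (δ + 2 * K)) :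
    trapezoid x δ K y = 0 := by
  have h : K + δ / 2 - |y - x| ≤ 0 := by
    by_contra! h
    have h' := abs_le.1 (show |y - x| ≤ K + δ / 2 by linarith)
    exact hy ⟨by linarith [h'.1], by linarith [h'.2]⟩
  rw [trapezoid, max_eq_left h, min_eq_right hK]

lemma integral_trapezoid_eq {μ : Measure ℝ} [IsProbabilityMeasure μ] {x δ : ℝ} (K : ℝ)
    (hμ : μ (J x δ) = 1) : ∫ y, trapezoid x δ K y ∂μ = K := by
  have hae : ∀ᵐ y ∂μ, y ∈ J x δ := (prob_compl_eq_zero_iff measurableSet_Icc).2 hμ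
  rw [integral_congr_ae (hae.mono fun y hy => trapezoid_eq_of_mem K hy)]
  simp

lemma integral_trapezoid_le {μ : Measure ℝ} [IsProbabilityMeasure μ] {K : ℝ} (hK : 0 ≤ K)
    (x δ : ℝ) : ∫ y, trapezoid x δ K y ∂μ ≤ K * μ.real (J x (δ + 2 * K)) := by
  have hJ : MeasurableSet (J x (δ + 2 * K)) := measurableSet_Icc
  calc ∫ y, trapezoid x δ K y ∂μ
      ≤ ∫ y, (J x (δ + 2 * K)).indicator (fun _ => K) y ∂μ := by
        refine integral_mono_of_nonneg (.of_forall (trapezoid_nonneg hK x δ))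
          ((integrable_const K).indicator hJ) (.of_forall fun y => ?_)
        by_cases hy : y ∈ J x (δ + 2 * K)
        · simpa [hy] using trapezoid_le x δ K y
        · simp [hy, trapezoid_eq_zero_of_notMem hK hy]
    _ = K * μ.real (J x (δ + 2 * K)) := by
        rw [integral_indicator_const K hJ, smul_eq_mul, mul_comm]

/-- If `μ` is concentrated on `J x δ` and `ν` is within Werner distance `c` of `μ`, then `ν`
gives mass at least `1 - ε` to the interval enlarged by `c / ε` on each side. -/
lemma one_sub_le_measure_J {μ ν : Measure ℝ} [IsProbabilityMeasure μ] [IsProbabilityMeasure ν]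
    {c ε x δ : ℝ} (hc : 0 < c) (hε : 0 < ε)
    (hd : ∀ h : ℝ → ℝ, (∃ C : ℝ, ∀ y, |h y| ≤ C) → LipschitzWith 1 h →
      |(∫ y, h y ∂ν) - ∫ y, h y ∂μ| ≤ c)
    (hμ : μ (J x δ) = 1) : ENNReal.ofReal (1 - ε) ≤ ν (J x (δ + 2 * c / ε)) := by
  have hK : 0 < c / ε := div_pos hc hε
  have hdist := hd (trapezoid x δ (c / ε))
    ⟨c / ε, fun y => by
      rw [abs_of_nonneg (trapezoid_nonneg hK.le x δ y)]
      exact trapezoid_le x δ (c / ε) y⟩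
    (lipschitzWith_trapezoid x δ (c / ε))
  rw [integral_trapezoid_eq _ hμ] at hdist
  have hle := integral_trapezoid_le (μ := ν) hK.le x δ
  have hcK : c / ε * ε = c := div_mul_cancel₀ c hε.ne'
  rw [mul_div_assoc, ENNReal.ofReal_le_iff_le_toReal (measure_ne_top _ _)]
  refine le_of_mul_le_mul_left (le_trans ?_ hle) hK
  linarith [(abs_le.1 hdist).1]

/-- Proposition 5: finite Werner distance implies finite error bars, with
`W_{ε,δ}(E₁,E) ≤ δ + 2c/ε` and `D_ε(E₁,E) ≤ 2c/ε`. -/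
theorem finite_distance_implies_approximation
    {S : Type*} [Nonempty S] (e e₁ : S → Measure ℝ)
    (he : ∀ ρ, IsProbabilityMeasure (e ρ))
    (he₁ : ∀ ρ, IsProbabilityMeasure (e₁ ρ))
    (hsupp : ∀ (x δ : ℝ), 0 < δ → ∃ ρ : S, e ρ (J x δ) = 1)
    (c : ℝ) (hc : 0 < c)
    (hd : ∀ (ρ : S) (h : ℝ → ℝ), (∃ C : ℝ, ∀ x, |h x| ≤ C) → LipschitzWith 1 h →
      |(∫ x, h x ∂(e₁ ρ)) - ∫ x, h x ∂(e ρ)| ≤ c)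
    (ε : ℝ) (hε : ε ∈ Set.Ioo (0 : ℝ) 1) :
    (∀ δ : ℝ, 0 < δ → errW e e₁ ε δ ≤ ENNReal.ofReal (δ + 2 * c / ε)) ∧
      errorBar e e₁ ε ≤ ENNReal.ofReal (2 * c / ε) := by
  have hW : ∀ δ : ℝ, 0 < δ → errW e e₁ ε δ ≤ ENNReal.ofReal (δ + 2 * c / ε) := by
    intro δ hδ
    have hK : 0 < 2 * c / ε := div_pos (by linarith) hε.1
    refine iInf₂_le (δ + 2 * c / ε) ⟨by linarith, fun x ρ hρ => ?_⟩
    have := he ρ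
    have := he₁ ρ
    exact one_sub_le_measure_J hc hε.1 (hd ρ) hρ
  refine ⟨hW, ENNReal.le_of_forall_pos_le_add fun η hη _ => ?_⟩
  have hη' : (0 : ℝ) < η := hη
  calc errorBar e e₁ ε ≤ errW e e₁ ε η := iInf₂_le (η : ℝ) hη'
    _ ≤ ENNReal.ofReal (η + 2 * c / ε) := hW η hη'
    _ ≤ ENNReal.ofReal η + ENNReal.ofReal (2 * c / ε) := ENNReal.ofReal_add_le
    _ = ENNReal.ofReal (2 * c / ε) + η := by rw [ENNReal.ofReal_coe_nnreal, add_comm]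
end
end

section
/- For every probability measure μ on ℝ and every ε ∈ (0,1), the overall width of μ is bounded by the bounded-Lipschitz distance of the smearing from the identity: W_ε(μ) ≤ (2/ε) · D_BL(μ), where D_BL(μ) := sup { |∫ h d(ν ∗ μ) − ∫ h dν| : ν a probability measure on ℝ, h : ℝ → ℝ bounded and 1-Lipschitz }. -/
open MeasureTheory Set
open scoped ENNReal

noncomputable section

/-- The bounded-Lipschitz distance `D_BL(μ)` of the smearing `Q_μ` from the sharp
position observable `Q` (the measure-level analogue of Werner's distance
`d(Q_μ, Q)`). -/
def DBL (μ : Measure ℝ) : ℝ≥0∞ :=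
  ⨆ (ν : Measure ℝ) (_ : IsProbabilityMeasure ν) (h : ℝ → ℝ)
    (_ : (∃ C : ℝ, ∀ x, |h x| ≤ C) ∧ LipschitzWith 1 h),
    ENNReal.ofReal |(∫ x, h x ∂(mconv ν μ)) - ∫ x, h x ∂ν|

theorem mconv_dirac_zero (μ : Measure ℝ) [SFinite μ] : mconv (Measure.dirac 0) μ = μ :=
  Measure.dirac_zero_conv μ

theorem lintegral_min_abs_le_DBL (μ : Measure ℝ) [IsProbabilityMeasure μ] {r : ℝ} (hr : 0 ≤ r) :
    ∫⁻ x, ENNReal.ofReal (min |x| r) ∂μ ≤ DBL μ := by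
  have hnonneg (x : ℝ) : 0 ≤ min |x| r := le_min (abs_nonneg x) hr
  have hbound (x : ℝ) : |min |x| r| ≤ r := by
    rw [abs_of_nonneg (hnonneg x)]
    exact min_le_right _ _
  have hlip : LipschitzWith 1 fun x : ℝ => min |x| r := by
    have h : LipschitzWith 1 fun x : ℝ => |x| := lipschitzWith_one_norm
    exact h.min_const r
  have hint : Integrable (fun x : ℝ => min |x| r) μ :=
    Integrable.of_bound hlip.continuous.aestronglyMeasurable r (ae_of_all _ hbound)
  have hle : ENNReal.ofReal |(∫ x, min |x| r ∂(mconv (Measure.dirac 0) μ)) -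
      ∫ x, min |x| r ∂(Measure.dirac (0 : ℝ))| ≤ DBL μ :=
    le_iSup₂_of_le (Measure.dirac (0 : ℝ)) inferInstance <|
      le_iSup₂_of_le (fun x : ℝ => min |x| r) ⟨⟨r, hbound⟩, hlip⟩ le_rfl
  rwa [mconv_dirac_zero, integral_dirac, abs_zero, min_eq_left hr, sub_zero,
    abs_of_nonneg (integral_nonneg hnonneg),
    ofReal_integral_eq_lintegral_ofReal hint (ae_of_all _ hnonneg)] at hle

theorem ofReal_mul_measure_compl_J_le_DBL (μ : Measure ℝ) [IsProbabilityMeasure μ]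
    {w : ℝ} (hw : 0 ≤ w) : ENNReal.ofReal (w / 2) * μ (J 0 w)ᶜ ≤ DBL μ := by
  refine le_trans ?_ (lintegral_min_abs_le_DBL μ (r := w / 2) (by positivity))
  have hsub : (J 0 w)ᶜ ⊆ {x | ENNReal.ofReal (w / 2) ≤ ENNReal.ofReal (min |x| (w / 2))} := by
    intro x hx
    refine ENNReal.ofReal_le_ofReal (le_min ?_ le_rfl)
    by_contra! h
    obtain ⟨h₁, h₂⟩ := abs_lt.mp h
    exact hx ⟨by linarith, by linarith⟩
  calc _ ≤ ENNReal.ofReal (w / 2) *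
        μ {x | ENNReal.ofReal (w / 2) ≤ ENNReal.ofReal (min |x| (w / 2))} := by gcongr
    _ ≤ _ := mul_meas_ge_le_lintegral (by fun_prop) _

theorem overall_width_le_bounded_lipschitz_distance
    (μ : Measure ℝ) [IsProbabilityMeasure μ]
    (ε : ℝ) (hε : ε ∈ Set.Ioo (0 : ℝ) 1) :
    overallWidth μ ε ≤ ENNReal.ofReal (2 / ε) * DBL μ := by
  obtain ⟨hε₀, -⟩ := hε
  refine le_of_forall_gt_imp_ge_of_dense fun c hc => ?_
  rcases eq_or_ne c ⊤ with rfl | hct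
  · exact le_top
  lift c to NNReal using hct
  have hw : 0 < (c : ℝ) := by exact_mod_cast (zero_le.trans_lt hc)
  have hc' : (c : ℝ≥0∞) = ENNReal.ofReal (2 / ε) * ENNReal.ofReal (c / 2) * ENNReal.ofReal ε := by
    rw [← ENNReal.ofReal_mul (by positivity), ← ENNReal.ofReal_mul (by positivity),
      show 2 / ε * ((c : ℝ) / 2) * ε = c by field_simp, ENNReal.ofReal_coe_nnreal]
  have hcompl : μ (J 0 c)ᶜ ≤ ENNReal.ofReal ε := by
    have h := (mul_le_mul_right (ofReal_mul_measure_compl_J_le_DBL μ hw.le)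
      (ENNReal.ofReal (2 / ε))).trans hc.le
    rw [hc', ← mul_assoc] at h
    refine (ENNReal.mul_le_mul_iff_right (mul_ne_zero ?_ ?_)
      (ENNReal.mul_ne_top ENNReal.ofReal_ne_top ENNReal.ofReal_ne_top)).mp h
    · exact (ENNReal.ofReal_pos.mpr (by positivity)).ne'
    · exact (ENNReal.ofReal_pos.mpr (by positivity)).ne'
  have hJ : ENNReal.ofReal (1 - ε) ≤ μ (J 0 c) := by
    rw [ENNReal.ofReal_sub _ hε₀.le, ENNReal.ofReal_one, tsub_le_iff_right]
    calc 1 = μ (J 0 c) + μ (J 0 c)ᶜ := (prob_add_prob_compl measurableSet_Icc).symm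
      _ ≤ _ := by gcongr
  exact (iInf₂_le (c : ℝ) ⟨hw, 0, hJ⟩).trans_eq ENNReal.ofReal_coe_nnreal
end
end

section
/- Let μ be a probability measure on ℝ with finite first absolute moment, ∫ |q| dμ(q) < ∞. Then the bounded-Lipschitz distance of the smearing from the identity equals the first absolute moment of μ: D_BL(μ) := sup { |∫ h d(ν ∗ μ) − ∫ h dν| : ν a probability measure on ℝ, h : ℝ → ℝ bounded and 1-Lipschitz } = ∫ |q| dμ(q). -/
open MeasureTheory Set
open scoped ENNReal

noncomputable section

open Filter Topology in
/-- The truncations `min |q| n` of the absolute value have integrals tending to the first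
absolute moment. -/
theorem tendsto_integral_min_abs (μ : Measure ℝ) (hmom : Integrable (fun q => |q|) μ) :
    Tendsto (fun n : ℕ => ∫ q, min |q| (n : ℝ) ∂μ) atTop (𝓝 (∫ q, |q| ∂μ)) := by
  refine tendsto_integral_of_dominated_convergence (fun q => |q|)
    (fun n => (by fun_prop : Continuous fun q : ℝ => min |q| (n : ℝ)).aestronglyMeasurable)
    hmom (fun n => .of_forall fun q => ?_) (.of_forall fun q => ?_)
  · rw [Real.norm_of_nonneg (by positivity)]
    exact min_le_left _ _
  · refine tendsto_const_nhds.congr' ?_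
    filter_upwards [eventually_ge_atTop ⌈|q|⌉₊] with n hn
    exact (min_eq_left (Nat.ceil_le.mp hn)).symm

theorem abs_integral_mconv_sub_le (ν μ : Measure ℝ) [IsProbabilityMeasure ν]
    [IsProbabilityMeasure μ] (hmom : Integrable (fun q => |q|) μ) {h : ℝ → ℝ}
    (hb : ∃ C : ℝ, ∀ x, |h x| ≤ C) (hL : LipschitzWith 1 h) :
    |(∫ x, h x ∂(mconv ν μ)) - ∫ x, h x ∂ν| ≤ ∫ q, |q| ∂μ := by
  obtain ⟨C, hC⟩ := hb
  have hc := hL.continuous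
  have hconv : ∫ x, h x ∂(mconv ν μ) = ∫ p : ℝ × ℝ, h (p.1 + p.2) ∂(ν.prod μ) :=
    integral_map (by fun_prop) hc.aestronglyMeasurable
  have hfst : ∫ x, h x ∂ν = ∫ p : ℝ × ℝ, h p.1 ∂(ν.prod μ) := by
    simp [integral_fun_fst h]
  have hsnd : ∫ q, |q| ∂μ = ∫ p : ℝ × ℝ, |p.2| ∂(ν.prod μ) := by
    simp [integral_fun_snd (fun q : ℝ => |q|)]
  have hint {g : ℝ × ℝ → ℝ} (hg : Continuous g) : Integrable (fun p => h (g p)) (ν.prod μ) :=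
    .of_bound (hc.comp hg).aestronglyMeasurable C (.of_forall fun p => hC (g p))
  rw [hconv, hfst, hsnd, ← integral_sub (hint (by fun_prop)) (hint continuous_fst),
    ← Real.norm_eq_abs]
  refine norm_integral_le_of_norm_le (hmom.comp_snd ν) (.of_forall fun p => ?_)
  simpa [Real.dist_eq] using hL.dist_le_mul (p.1 + p.2) p.1

/-- For a noise measure `μ` with finite first absolute moment, the bounded-Lipschitz
distance of the smearing from the identity equals the first absolute moment of `μ`. -/
theorem bounded_lipschitz_distance_eq_first_moment
    (μ : Measure ℝ) [IsProbabilityMeasure μ]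
    (hmom : Integrable (fun q => |q|) μ) :
    DBL μ = ENNReal.ofReal (∫ q, |q| ∂μ) := by
  apply le_antisymm
  · exact iSup_le fun ν => iSup_le fun _ => iSup_le fun h => iSup_le fun hh =>
      ENNReal.ofReal_le_ofReal (abs_integral_mconv_sub_le ν μ hmom hh.1 hh.2)
  · refine le_of_tendsto' (ENNReal.tendsto_ofReal (tendsto_integral_min_abs μ hmom)) fun n => ?_
    have hh : (∃ C : ℝ, ∀ x : ℝ, |min |x| (n : ℝ)| ≤ C) ∧
        LipschitzWith 1 fun x : ℝ => min |x| (n : ℝ) := by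
      refine ⟨⟨n, fun x => ?_⟩, lipschitzWith_one_norm.min_const n⟩
      rw [abs_of_nonneg (by positivity)]
      exact min_le_right _ _
    refine le_trans ?_ (le_iSup₂_of_le (Measure.dirac 0) inferInstance
      (le_iSup₂_of_le (fun x : ℝ => min |x| (n : ℝ)) hh le_rfl))
    rw [mconv_dirac_zero]
    refine ENNReal.ofReal_le_ofReal ?_
    simpa using le_abs_self _
end
end
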